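/- Let a = (a_1, a_2, a_1, a_2, …) be the 2-periodic sequence with a_1 < 1/3 and a_2 > 1/3. If a_1 ∈ (1/35, (6√5 − 13)/11) and a_2 ≤ (3a_1 + 1 − 4√(a_1² + a_1))/(1 − a_1), then C(a) − C(a) is a Cantorval. -/

import Mathlib

open Pointwise MeasureTheory

namespace CCS

/-- `dSeq a n` is the common length `d_n = ∏_{i=1}^n (1 - a_i)/2` of the intervals of the
`n`-th step of the construction of the central Cantor set `C(a)` (`d_0 = 1`).
The sequence `a` is indexed from `1`; the value `a 0` is irrelevant. -/
noncomputable def dSeq (a : ℕ → ℝ) (n : ℕ) : ℝ :=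
  ∏ i ∈ Finset.Icc 1 n, ((1 - a i) / 2)

/-- Left endpoint of the interval `I_t`, `t ∈ {0,1}^n` (coded as a list, the paper's
`t_j` being `t.getD (j-1) 0`): `l(I_t) = ∑_{j=1}^n t_j (d_{j-1} - d_j)`. -/
noncomputable def Il (a : ℕ → ℝ) (t : List ℕ) : ℝ :=
  ∑ j ∈ Finset.range t.length, (t.getD j 0 : ℝ) * (dSeq a j - dSeq a (j + 1))

/-- The `n`-th step `C_n(a)` of the construction of the central Cantor set:
the union of the intervals `I_t = [l(I_t), l(I_t) + d_n]` over `t ∈ {0,1}^n`. -/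
noncomputable def cantorStep (a : ℕ → ℝ) (n : ℕ) : Set ℝ :=
  ⋃ t ∈ {t : List ℕ | t.length = n ∧ ∀ j ∈ t, j ≤ 1},
    Set.Icc (Il a t) (Il a t + dSeq a n)

/-- The central Cantor set `C(a) = ⋂ₙ C_n(a)`. -/
noncomputable def cantorSet (a : ℕ → ℝ) : Set ℝ := ⋂ n, cantorStep a n

/-- Left endpoint of the interval `J_s = I_t - I_p`, for `s ∈ {0,1,2}^n`:
`l(J_s) = -1 + ∑_{j=1}^n s_j (d_{j-1} - d_j)`. -/
noncomputable def Jl (a : ℕ → ℝ) (s : List ℕ) : ℝ :=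
  -1 + ∑ j ∈ Finset.range s.length, (s.getD j 0 : ℝ) * (dSeq a j - dSeq a (j + 1))

/-- Right endpoint of `J_s`: `r(J_s) = l(J_s) + 2 d_n`. -/
noncomputable def Jr (a : ℕ → ℝ) (s : List ℕ) : ℝ :=
  Jl a s + 2 * dSeq a s.length

/-- The interval `J_s`. -/
noncomputable def Jset (a : ℕ → ℝ) (s : List ℕ) : Set ℝ := Set.Icc (Jl a s) (Jr a s)

/-- Left endpoint of the gap `G^i_s` (`i = 0`: left gap, `i = 1`: right gap) of `J_s`. -/
noncomputable def Gl (a : ℕ → ℝ) (i : ℕ) (s : List ℕ) : ℝ :=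
  Jl a s + (i : ℝ) * (dSeq a s.length - dSeq a (s.length + 1)) + 2 * dSeq a (s.length + 1)

/-- Right endpoint of the gap `G^i_s`. -/
noncomputable def Gr (a : ℕ → ℝ) (i : ℕ) (s : List ℕ) : ℝ :=
  Jl a s + ((i : ℝ) + 1) * (dSeq a s.length - dSeq a (s.length + 1))

/-- The gap `G^i_s ⊆ J_s`, an open interval. -/
noncomputable def Gset (a : ℕ → ℝ) (i : ℕ) (s : List ℕ) : Set ℝ :=
  Set.Ioo (Gl a i s) (Gr a i s)

/-- `N(0,s) = max {j : s_j > 0}`, `N(1,s) = max {j : s_j < 2}` (1-based, `max ∅ = 0`). -/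
noncomputable def Nidx (i : ℕ) (s : List ℕ) : ℕ :=
  sSup {j | 1 ≤ j ∧ j ≤ s.length ∧
    (if i = 0 then 0 < s.getD (j - 1) 0 else s.getD (j - 1) 0 < 2)}

/-- The family `𝒢^{i0}_{s0}(n)` of (indices of) gaps of rank `n`, for
`s0 ∈ {0,1,2}^{k_m - 1}`; a gap `G^i_s` is coded by the pair `(i, s)`.
`𝒢^{i0}_{s0}(m) = {G^{i0}_{s0}}` and for `n > m`,
`𝒢^{i0}_{s0}(n)` consists of the gap `Ḡ^{i0}_{s0}(n)` together with the gaps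
`Ḡ^1_{t^j}(n)`, `Ḡ^0_{t^(j+1)}(n)` for all `G^j_t ∈ 𝒢^{i0}_{s0}(l)`, `m ≤ l < n`. -/
def gapFamily (k : ℕ → ℕ) (i0 : ℕ) (s0 : List ℕ) (m : ℕ) (n : ℕ) : Set (ℕ × List ℕ) :=
  if n ≤ m then {(i0, s0)}
  else
    {(i0, s0 ++ List.replicate (k n - k m) (2 * i0))} ∪
      ⋃ (l : ℕ) (_ : m ≤ l) (hl : l < n),
        ⋃ p ∈ gapFamily k i0 s0 m l,
          ({(1, p.2 ++ p.1 :: List.replicate (k n - k l - 1) 2),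
            (0, p.2 ++ (p.1 + 1) :: List.replicate (k n - k l - 1) 0)} : Set (ℕ × List ℕ))
termination_by n
decreasing_by exact hl

/-- The family `𝒢^{i0}_{s0} = ⋃_{n ≥ m} 𝒢^{i0}_{s0}(n)`. -/
def gapFamilyAll (k : ℕ → ℕ) (i0 : ℕ) (s0 : List ℕ) (m : ℕ) : Set (ℕ × List ℕ) :=
  ⋃ (n : ℕ) (_ : m ≤ n), gapFamily k i0 s0 m n

/-- The family `𝒢_t := 𝒢^0_{t ++ 0^{(k_m - |t| - 1)}} ∪ 𝒢^1_{t ++ 2^{(k_m - |t| - 1)}}`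
for `t ∈ {0,1,2}^k` with `k_{m-1} ≤ k < k_m`. -/
def gapFamilyT (k : ℕ → ℕ) (m : ℕ) (t : List ℕ) : Set (ℕ × List ℕ) :=
  gapFamilyAll k 0 (t ++ List.replicate (k m - t.length - 1) 0) m ∪
    gapFamilyAll k 1 (t ++ List.replicate (k m - t.length - 1) 2) m

/-- The union `⋃ 𝒢` of a family of (indices of) gaps, as a subset of `ℝ`. -/
noncomputable def gapUnion (a : ℕ → ℝ) (G : Set (ℕ × List ℕ)) : Set ℝ :=
  ⋃ p ∈ G, Gset a p.1 p.2

/-- `padSeq k c s m n` is the index of the gap `G^i(s,n)` (for `c = 2i`):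
`s ++ c^{(k_m - |s| - 1)} ++ 1 ++ c^{(k_{m+1} - k_m - 1)} ++ 1 ++ ⋯ ++ 1 ++ c^{(k_n - k_{n-1} - 1)}`. -/
def padSeq (k : ℕ → ℕ) (c : ℕ) (s : List ℕ) (m : ℕ) : ℕ → List ℕ
  | 0 => s ++ List.replicate (k m - s.length - 1) c
  | n + 1 =>
    if n + 1 ≤ m then s ++ List.replicate (k m - s.length - 1) c
    else padSeq k c s m n ++ 1 :: List.replicate (k (n + 1) - k n - 1) c

/-- `δ_n := min {3d_i - d_{i-1} : k_{n-1} + 1 ≤ i ≤ k_n - 1}` (as an element of `EReal`,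
so that `min ∅ = ⊤ = ∞`). -/
noncomputable def deltaMin (a : ℕ → ℝ) (k : ℕ → ℕ) (n : ℕ) : EReal :=
  sInf ((fun i => ((3 * dSeq a i - dSeq a (i - 1) : ℝ) : EReal)) ''
    (Set.Icc (k (n - 1) + 1) (k n - 1)))

/-- `Δ_n := max {3d_i - d_{i-1} : k_{n-1} + 1 ≤ i ≤ k_n - 1}` (`max ∅ = ⊥ = -∞`). -/
noncomputable def deltaMax (a : ℕ → ℝ) (k : ℕ → ℕ) (n : ℕ) : EReal :=
  sSup ((fun i => ((3 * dSeq a i - dSeq a (i - 1) : ℝ) : EReal)) ''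
    (Set.Icc (k (n - 1) + 1) (k n - 1)))

/-- `m_n := min { δ_n - (d_{k_n - 1} - d_{k_n}), 4 d_{k_n} - Δ_n }`. -/
noncomputable def mSeq (a : ℕ → ℝ) (k : ℕ → ℕ) (n : ℕ) : EReal :=
  min (deltaMin a k n - ((dSeq a (k n - 1) - dSeq a (k n) : ℝ) : EReal))
    (((4 * dSeq a (k n) : ℝ) : EReal) - deltaMax a k n)

/-- `∑_{i=n+1}^∞ (d_{k_i - 1} - d_{k_i})`. -/
noncomputable def tailSum (a : ℕ → ℝ) (k : ℕ → ℕ) (n : ℕ) : ℝ :=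
  ∑' i : ℕ, (dSeq a (k (n + 1 + i) - 1) - dSeq a (k (n + 1 + i)))

/-- Condition `(*)`: `m_n ≥ 2 ∑_{i=n+1}^∞ (d_{k_i - 1} - d_{k_i})` for every `n ∈ ℕ`. -/
def condStar (a : ℕ → ℝ) (k : ℕ → ℕ) : Prop :=
  ∀ n : ℕ, 1 ≤ n → ((2 * tailSum a k n : ℝ) : EReal) ≤ mSeq a k n

/-- `(k_n)_{n ≥ 1}` is the increasing enumeration of all indices greater than `k 0 = k₀`
at which `a` exceeds `1/3`. -/
def IsGapEnum (a : ℕ → ℝ) (k : ℕ → ℕ) : Prop :=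
  StrictMono k ∧ (∀ n, 1 ≤ n → k 0 < k n ∧ 1 / 3 < a (k n)) ∧
    (∀ j, k 0 < j → 1 / 3 < a j → ∃ n, 1 ≤ n ∧ k n = j)

/-- `G` is a gap of `E`: a bounded connected component of `ℝ ∖ E`. -/
def IsGapOf (E G : Set ℝ) : Prop :=
  (∃ x ∉ E, G = connectedComponentIn Eᶜ x) ∧ Bornology.IsBounded G

/-- `C` is a proper (nontrivial) connected component of `E`. -/
def IsProperComponentOf (E C : Set ℝ) : Prop :=
  (∃ x ∈ E, C = connectedComponentIn E x) ∧ C.Nontrivial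

/-- `E` is a Cantorval: a perfect set with infinitely many gaps such that both endpoints
of every gap are accumulated both by gaps and by proper components of `E`. -/
def IsCantorval (E : Set ℝ) : Prop :=
  Perfect E ∧ {G : Set ℝ | IsGapOf E G}.Infinite ∧
    ∀ G, IsGapOf E G → ∀ p, p = sInf G ∨ p = sSup G →
      (∀ ε > 0, ∃ G', IsGapOf E G' ∧ G' ≠ G ∧ G' ⊆ Set.Ioo (p - ε) (p + ε)) ∧
      (∀ ε > 0, ∃ C, IsProperComponentOf E C ∧ C ⊆ Set.Ioo (p - ε) (p + ε))

/-- `J_s` and `J_u` (of length `k_m - 1`) are associated: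
`N := N(0,s) = N(1,u) ∈ {k_{m-1}+1, …, k_m - 1}`, `s|(N-1) = u|(N-1)`, `u_N = s_N - 1`.
Then `J_u` is the interval covering `𝒢^0_s` and `J_s` is the interval covering `𝒢^1_u`. -/
def Associated (k : ℕ → ℕ) (m : ℕ) (s u : List ℕ) : Prop :=
  s.length = k m - 1 ∧ u.length = k m - 1 ∧
    Nidx 0 s = Nidx 1 u ∧
    k (m - 1) + 1 ≤ Nidx 0 s ∧ Nidx 0 s ≤ k m - 1 ∧
    s.take (Nidx 0 s - 1) = u.take (Nidx 0 s - 1) ∧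
    u.getD (Nidx 0 s - 1) 0 = s.getD (Nidx 0 s - 1) 0 - 1

/-- `G^i_g ⊂_* J_v`: the gap `G^i_g` is covered by the interval `J_v`, i.e. `G^i_g`
belongs to a family `𝒢^0_w` (resp. `𝒢^1_w`) such that `J_v` is the interval covering it. -/
def CoversGap (k : ℕ → ℕ) (i : ℕ) (g : List ℕ) (v : List ℕ) : Prop :=
  ∃ m w, 1 ≤ m ∧
    ((Associated k m w v ∧ (i, g) ∈ gapFamilyAll k 0 w m) ∨
      (Associated k m v w ∧ (i, g) ∈ gapFamilyAll k 1 w m))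

/-- The achievement set `E(x) = {∑_{j ∈ A} x_j : A ⊆ ℕ}` of a series (indexed from `1`). -/
def achievementSet (x : ℕ → ℝ) : Set ℝ :=
  {y | ∃ A : Set ℕ, A ⊆ {n | 1 ≤ n} ∧ HasSum (A.indicator x) y}

/-! ### Abstract part: a self-similar set -/

/-- The digits `i x + j y`, `i, j ∈ {-1,0,1}`. -/
def Dig (x y : ℝ) : Set ℝ :=
  Set.image2 (fun i j => i * x + j * y) ({-1, 0, 1} : Set ℝ) ({-1, 0, 1} : Set ℝ)

lemma dig_finite (x y : ℝ) : (Dig x y).Finite := by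
  unfold Dig
  exact Set.Finite.image2 _ (by simp) (by simp)

/-- The abstract properties of `E = C(a) - C(a)` used in the proof. -/
structure SelfSim (E : Set ℝ) (l x y : ℝ) : Prop where
  l0 : 0 < l
  l1 : l < 1
  sum : x + y = 1 - l
  y0 : 0 ≤ y
  yx : y ≤ x
  gap : -1 + 2 * l < -x - l
  c1 : (x - y) * (1 - l) ≤ 2 * l * x
  c2 : (2 * y - x) * (1 - l) ≤ 2 * l * x
  closed : IsClosed E
  sub : E ⊆ Set.Icc (-1) 1
  one : (1 : ℝ) ∈ E
  neg : ∀ z ∈ E, -z ∈ E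
  into : ∀ z ∈ E, ∀ d ∈ Dig x y, l * z + d ∈ E
  from' : ∀ z ∈ E, ∃ w ∈ E, ∃ d ∈ Dig x y, z = l * w + d

/-- Translations of the level `n` cylinders. -/
def Tr (l x y : ℝ) : ℕ → Set ℝ
  | 0 => {0}
  | n + 1 => Set.image2 (fun t d => t + l ^ n * d) (Tr l x y n) (Dig x y)

lemma tr_finite (l x y : ℝ) (n : ℕ) : (Tr l x y n).Finite := by
  induction n with
  | zero => simp [Tr]
  | succ n ih => exact Set.Finite.image2 _ ih (dig_finite x y)

namespace SelfSim

variable {E : Set ℝ} {l x y : ℝ}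

lemma tr_into (H : SelfSim E l x y) (n : ℕ) : ∀ z ∈ E, ∀ t ∈ Tr l x y n, l ^ n * z + t ∈ E := by
  induction n with
  | zero => intro z hz t ht; simp [Tr] at ht; simpa [ht] using hz
  | succ n ih =>
    intro z hz t ht
    obtain ⟨t, ht, d, hd, rfl⟩ := ht
    have := ih _ (H.into z hz d hd) t ht
    convert this using 1
    ring

lemma tr_from (H : SelfSim E l x y) (n : ℕ) :
    ∀ z ∈ E, ∃ w ∈ E, ∃ t ∈ Tr l x y n, z = l ^ n * w + t := by
  induction n with
  | zero => intro z hz; exact ⟨z, hz, 0, by simp [Tr], by simp⟩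
  | succ n ih =>
    intro z hz
    obtain ⟨w, hw, t, ht, rfl⟩ := ih z hz
    obtain ⟨w', hw', d, hd, rfl⟩ := H.from' w hw
    exact ⟨w', hw', _, ⟨t, ht, d, hd, rfl⟩, by ring⟩

lemma neg_one (H : SelfSim E l x y) : (-1 : ℝ) ∈ E := H.neg 1 H.one

lemma dmin (x y : ℝ) : -x - y ∈ Dig x y := ⟨-1, by simp, -1, by simp, by ring⟩

lemma dig_cases (H : SelfSim E l x y) {d : ℝ} (hd : d ∈ Dig x y) : d = -x - y ∨ -x ≤ d := by
  have := H.y0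
  have := H.yx
  obtain ⟨i, hi, j, hj, rfl⟩ := hd
  simp only [Set.mem_insert_iff, Set.mem_singleton_iff] at hi hj
  rcases hi with rfl | rfl | rfl <;> rcases hj with rfl | rfl | rfl <;>
    first
    | (left; ring; done)
    | (right; linarith)

/-- pulling toward `-1` keeps `E`. -/
lemma pull (H : SelfSim E l x y) (k : ℕ) : ∀ z ∈ E, -1 + l ^ k * (z + 1) ∈ E := by
  induction k with
  | zero => intro z hz; simpa using hz
  | succ k ih =>
    intro z hz
    have := ih _ (H.into z hz _ (dmin x y))
    have hs := H.sum
    convert this using 1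
    have : x = 1 - l - y := by linarith
    subst this
    ring

lemma gap0 (H : SelfSim E l x y) : ∀ z ∈ E, z < -x - l → z ≤ -1 + 2 * l := by
  intro z hz hlt
  obtain ⟨w, hw, d, hd, rfl⟩ := H.from' z hz
  have hw' := H.sub hw
  have := H.l0
  have hs := H.sum
  rcases H.dig_cases hd with rfl | h
  · nlinarith [hw'.1, hw'.2]
  · nlinarith [hw'.1, hw'.2]

lemma gapk (H : SelfSim E l x y) (k : ℕ) :
    ∀ z ∈ E, z < -1 + l ^ k * (1 - x - l) → z ≤ -1 + l ^ k * (2 * l) := by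
  have hl := H.l0
  have hg := H.gap
  have hl1 := H.l1
  have hs := H.sum
  have hy := H.y0
  have hyx := H.yx
  induction k with
  | zero => intro z hz h; have := H.gap0 z hz (by simp at h; linarith); simpa using this
  | succ k ih =>
    intro z hz h
    have hpk : l ^ k ≤ 1 := pow_le_one₀ hl.le hl1.le
    have hpk0 : 0 < l ^ k := pow_pos hl k
    have hp : l ^ (k + 1) ≤ l := by rw [pow_succ]; nlinarith
    have hp0 : 0 < l ^ (k + 1) := pow_pos hl _
    have hsm : z < -x - l := by nlinarith
    obtain ⟨w, hw, d, hd, rfl⟩ := H.from' z hz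
    have hw' := H.sub hw
    rcases H.dig_cases hd with rfl | h'
    · have e : l * w + (-x - y) = -1 + l * (w + 1) := by linarith
      rw [e] at h ⊢
      have h2 : w < -1 + l ^ k * (1 - x - l) := by
        rw [pow_succ] at h
        by_contra hc
        push Not at hc
        nlinarith
      have := ih w hw h2
      rw [pow_succ]
      nlinarith
    · nlinarith [hw'.1, hw'.2]

lemma u_mem (H : SelfSim E l x y) : -1 + 2 * l ∈ E := by
  have := H.into 1 H.one _ (dmin x y)
  have hs := H.sum
  convert this using 1
  linarith

lemma v_mem (H : SelfSim E l x y) : -x - l ∈ E := by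
  have := H.into (-1) H.neg_one (-x) ⟨-1, by simp, 0, by simp, by ring⟩
  convert this using 1
  ring

lemma x_pos (H : SelfSim E l x y) : 0 < x := by
  have := H.sum
  have := H.yx
  have := H.l1
  linarith

lemma h_eq (H : SelfSim E l x y) : x / (1 - l) = x + l * (x / (1 - l)) := by
  have : (1 - l) ≠ 0 := by have := H.l1; linarith
  field_simp
  ring

lemma cover (H : SelfSim E l x y) (z : ℝ) (hz : |z| ≤ x / (1 - l)) :
    ∃ w d, d ∈ Dig x y ∧ |w| ≤ x / (1 - l) ∧ z = l * w + d := by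
  have hl := H.l0
  have hl1 : 0 < 1 - l := by have := H.l1; linarith
  set h := x / (1 - l) with hh
  have he : h = x + l * h := H.h_eq
  have hx : x = h * (1 - l) := by rw [hh]; field_simp
  have c1 : x - y ≤ 2 * (l * h) := by
    have := H.c1
    have h3 : (x - y) * (1 - l) ≤ (2 * (l * h)) * (1 - l) := by
      calc _ ≤ _ := this
        _ = _ := by rw [hx]; ring
    exact le_of_mul_le_mul_right h3 hl1
  have c2 : 2 * y - x ≤ 2 * (l * h) := by
    have := H.c2
    have h3 : (2 * y - x) * (1 - l) ≤ (2 * (l * h)) * (1 - l) := by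
      calc _ ≤ _ := this
        _ = _ := by rw [hx]; ring
    exact le_of_mul_le_mul_right h3 hl1
  suffices hd : ∃ d ∈ Dig x y, |z - d| ≤ l * h by
    obtain ⟨d, hd, hb⟩ := hd
    refine ⟨(z - d) / l, d, hd, ?_, by field_simp; ring⟩
    rw [abs_div, abs_of_pos hl, div_le_iff₀ hl]
    linarith
  set r := l * h with hr
  rw [he] at hz
  rw [abs_le] at hz
  by_cases h1 : z ≤ -x + r
  · exact ⟨-x, ⟨-1, by simp, 0, by simp, by ring⟩, by rw [abs_le]; constructor <;> linarith⟩
  by_cases h2 : z ≤ -y + r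
  · exact ⟨-y, ⟨0, by simp, -1, by simp, by ring⟩, by rw [abs_le]; constructor <;> linarith⟩
  by_cases h3 : z ≤ -(x - y) + r
  · exact ⟨-(x - y), ⟨-1, by simp, 1, by simp, by ring⟩, by rw [abs_le]; constructor <;> linarith⟩
  by_cases h4 : z ≤ r
  · exact ⟨0, ⟨0, by simp, 0, by simp, by ring⟩, by rw [abs_le]; constructor <;> linarith⟩
  by_cases h5 : z ≤ x - y + r
  · exact ⟨x - y, ⟨1, by simp, -1, by simp, by ring⟩, by rw [abs_le]; constructor <;> linarith⟩
  by_cases h6 : z ≤ y + r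
  · exact ⟨y, ⟨0, by simp, 1, by simp, by ring⟩, by rw [abs_le]; constructor <;> linarith⟩
  · exact ⟨x, ⟨1, by simp, 0, by simp, by ring⟩, by rw [abs_le]; constructor <;> linarith⟩

lemma approx (H : SelfSim E l x y) (n : ℕ) : ∀ z : ℝ, |z| ≤ x / (1 - l) →
    ∃ e ∈ E, |z - e| ≤ l ^ n * (x / (1 - l) + 1) := by
  have hl := H.l0
  induction n with
  | zero =>
    intro z hz
    refine ⟨1, H.one, ?_⟩
    have := abs_sub z 1
    simp at this ⊢
    linarith
  | succ n ih =>
    intro z hz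
    obtain ⟨w, d, hd, hw, rfl⟩ := H.cover z hz
    obtain ⟨e, he, hb⟩ := ih w hw
    refine ⟨l * e + d, H.into e he d hd, ?_⟩
    have : l * w + d - (l * e + d) = l * (w - e) := by ring
    rw [this, abs_mul, abs_of_pos hl, pow_succ]
    nlinarith

lemma interval (H : SelfSim E l x y) (z : ℝ) (hz : |z| ≤ x / (1 - l)) : z ∈ E := by
  have hl := H.l0
  have hcl := H.closed
  rw [← hcl.closure_eq, Metric.mem_closure_iff]
  intro ε hε
  have hx := H.x_pos
  have hM : 0 < x / (1 - l) + 1 := by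
    have : 0 < 1 - l := by have := H.l1; linarith
    positivity
  obtain ⟨n, hn⟩ := exists_pow_lt_of_lt_one (div_pos hε hM) H.l1
  obtain ⟨e, he, hb⟩ := H.approx n z hz
  refine ⟨e, he, ?_⟩
  rw [Real.dist_eq]
  rw [lt_div_iff₀ hM] at hn
  linarith

/-- Local structure of `E` to the right of the right endpoint of a gap. -/
lemma local_right (H : SelfSim E l x y) {p q : ℝ} (hpq : p < q) (hq : q ∈ E)
    (hno : ∀ z ∈ E, z < q → z ≤ p) :
    ∃ n, ∃ η > 0, (∀ e ∈ E, q + l ^ n * (e + 1) ∈ E) ∧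
      (∀ z ∈ E, q ≤ z → z < q + η → ∃ e ∈ E, z = q + l ^ n * (e + 1)) := by
  have hl := H.l0
  obtain ⟨n, hn⟩ := exists_pow_lt_of_lt_one (show 0 < (q - p) / 2 by linarith) H.l1
  have hpn : 0 < l ^ n := pow_pos hl n
  obtain ⟨e, he, t, ht, hqe⟩ := H.tr_from n q hq
  have heb := H.sub he
  have hm := H.tr_into n (-1) H.neg_one t ht
  have hte : t = q + l ^ n := by
    by_contra hne
    have h1 : l ^ n * (-1) + t ≠ q := fun h => hne (by linarith)
    have h2 : l ^ n * (-1) + t ≤ q := by nlinarith [heb.1]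
    have := hno _ hm (lt_of_le_of_ne h2 h1)
    nlinarith [heb.2]
  subst hte
  have hfin : ∃ η > 0, ∀ t' ∈ Tr l x y n, q + l ^ n < t' → q + l ^ n + η ≤ t' := by
    by_cases hne : (Tr l x y n ∩ Set.Ioi (q + l ^ n)).Nonempty
    · obtain ⟨m, hm, hmin⟩ := Set.exists_min_image _ id
        ((tr_finite l x y n).inter_of_left (Set.Ioi (q + l ^ n))) hne
      refine ⟨m - (q + l ^ n), by have := hm.2; simp at this; linarith, ?_⟩
      intro t' ht' hlt
      have := hmin t' ⟨ht', hlt⟩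
      simp at this
      linarith
    · refine ⟨1, one_pos, ?_⟩
      intro t' ht' hlt
      exact absurd ⟨t', ht', hlt⟩ hne
  obtain ⟨η, hη, hfin⟩ := hfin
  refine ⟨n, η, hη, ?_, ?_⟩
  · intro e he
    have := H.tr_into n e he _ ht
    convert this using 1
    ring
  · intro z hz hqz hzη
    obtain ⟨w, hw, t', ht', rfl⟩ := H.tr_from n z hz
    have hwb := H.sub hw
    have hm' := H.tr_into n (-1) H.neg_one t' ht'
    rcases lt_trichotomy t' (q + l ^ n) with h | h | h
    · have := hno _ hm' (by linarith)
      exfalso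
      nlinarith [hwb.2]
    · exact ⟨w, hw, by rw [h]; ring⟩
    · have := hfin t' ht' h
      exfalso
      nlinarith [hwb.1]

lemma acc_right (H : SelfSim E l x y) {p q : ℝ} (hpq : p < q) (hq : q ∈ E)
    (hno : ∀ z ∈ E, z < q → z ≤ p) (ε : ℝ) (hε : 0 < ε) :
    (∃ u ∈ E, ∃ v ∈ E, q < u ∧ u < v ∧ v < q + ε ∧ ∀ z ∈ E, z < v → z ≤ u) ∧
    (∃ α β, q ≤ α ∧ α < β ∧ β < q + ε ∧ Set.Icc α β ⊆ E) := by
  have hl := H.l0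
  have hs := H.sum
  have hg := H.gap
  have hy := H.y0
  have hx := H.x_pos
  have hl1 : 0 < 1 - l := by have := H.l1; linarith
  obtain ⟨n, η, hη, hin, hout⟩ := H.local_right hpq hq hno
  obtain ⟨k, hk⟩ := exists_pow_lt_of_lt_one (show 0 < min ε η / 3 by positivity) H.l1
  have hpn : 0 < l ^ n := pow_pos hl n
  have hpn1 : l ^ n ≤ 1 := pow_le_one₀ hl.le H.l1.le
  have hpk : 0 < l ^ k := pow_pos hl k
  have hmul : l ^ n * l ^ k ≤ l ^ k := by nlinarith
  have hmp : 0 < l ^ n * l ^ k := by positivity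
  have hε' : 3 * (l ^ n * l ^ k) < ε := by
    have := min_le_left ε η; linarith
  have hη' : 3 * (l ^ n * l ^ k) < η := by
    have := min_le_right ε η; linarith
  constructor
  · refine ⟨q + l ^ n * ((-1 + l ^ k * ((-1 + 2 * l) + 1)) + 1), hin _ (H.pull k _ H.u_mem),
      q + l ^ n * ((-1 + l ^ k * ((-x - l) + 1)) + 1), hin _ (H.pull k _ H.v_mem), ?_, ?_, ?_, ?_⟩
    · have : 0 < l ^ n * l ^ k * l := by positivity
      nlinarith
    · nlinarith
    · nlinarith
    · intro z hz hzv
      by_cases hzq : z < q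
      · have := hno z hz hzq
        have : 0 < l ^ n * l ^ k * l := by positivity
        nlinarith
      push Not at hzq
      obtain ⟨e, he, rfl⟩ := hout z hz hzq (by nlinarith)
      have h1 : e < -1 + l ^ k * (1 - x - l) := by
        by_contra hc
        push Not at hc
        nlinarith
      have := H.gapk k e he h1
      nlinarith
  · have hh : 0 < x / (1 - l) := by positivity
    set h := min (x / (1 - l)) 1 with hhd
    have hh0 : 0 < h := by positivity
    have hh1 : h ≤ 1 := min_le_right _ _
    have hh2 : h ≤ x / (1 - l) := min_le_left _ _
    refine ⟨q + l ^ n * l ^ k * (0 + 1), q + l ^ n * l ^ k * (h + 1), by nlinarith, by nlinarith,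
      by nlinarith, ?_⟩
    intro z hz
    have hz1 := hz.1
    have hz2 := hz.2
    set w := (z - q) / (l ^ n * l ^ k) - 1 with hw
    have hzw : z = q + l ^ n * ((-1 + l ^ k * (w + 1)) + 1) := by
      rw [hw]; field_simp; ring
    rw [hzw]
    apply hin
    apply H.pull
    apply H.interval
    have a1 : 0 + 1 ≤ (z - q) / (l ^ n * l ^ k) := by
      rw [le_div_iff₀ hmp]; linarith
    have a2 : (z - q) / (l ^ n * l ^ k) ≤ h + 1 := by
      rw [div_le_iff₀ hmp]; linarith
    rw [abs_le]
    constructor <;> linarith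

lemma acc_left (H : SelfSim E l x y) {p q : ℝ} (hpq : p < q) (hp : p ∈ E)
    (hno : ∀ z ∈ E, z < q → z ≤ p) (ε : ℝ) (hε : 0 < ε) :
    (∃ u ∈ E, ∃ v ∈ E, p - ε < u ∧ u < v ∧ v < p ∧ ∀ z ∈ E, z < v → z ≤ u) ∧
    (∃ α β, p - ε < α ∧ α < β ∧ β ≤ p ∧ Set.Icc α β ⊆ E) := by
  obtain ⟨⟨u, hu, v, hv, h1, h2, h3, h4⟩, α, β, g1, g2, g3, g4⟩ :=
    H.acc_right (neg_lt_neg hpq) (H.neg p hp) (by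
      intro z hz hzp
      by_contra hc
      push Not at hc
      have := hno _ (H.neg z hz) (by linarith)
      linarith) ε hε
  refine ⟨⟨-v, H.neg v hv, -u, H.neg u hu, by linarith, by linarith, by linarith, ?_⟩,
    -β, -α, by linarith, by linarith, by linarith, ?_⟩
  · intro z hz hzu
    by_contra hc
    push Not at hc
    have := h4 _ (H.neg z hz) (by linarith)
    linarith
  · intro z hz
    have := H.neg _ (g4 (show -z ∈ Set.Icc α β from ⟨by linarith [hz.2], by linarith [hz.1]⟩))
    simpa using this

end SelfSim

/-! ### Gaps and components -/

lemma isGap_Ioo {E : Set ℝ} {p q : ℝ} (hpq : p < q) (hp : p ∈ E) (hq : q ∈ E)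
    (hno : ∀ z ∈ E, z < q → z ≤ p) : IsGapOf E (Set.Ioo p q) := by
  have hsub : Set.Ioo p q ⊆ Eᶜ := by
    intro z hz hzE
    have := hno z hzE hz.2
    linarith [hz.1]
  have hmid : (p + q) / 2 ∈ Set.Ioo p q := ⟨by linarith, by linarith⟩
  refine ⟨⟨(p + q) / 2, hsub hmid, ?_⟩, Metric.isBounded_Ioo p q⟩
  apply Set.Subset.antisymm
  · exact isPreconnected_Ioo.subset_connectedComponentIn hmid hsub
  · have hoc := (isPreconnected_connectedComponentIn (x := (p + q) / 2) (F := Eᶜ)).ordConnected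
    have hm := mem_connectedComponentIn (hsub hmid)
    have hcs := connectedComponentIn_subset Eᶜ ((p + q) / 2)
    intro z hz
    constructor
    · by_contra hc
      push Not at hc
      exact hcs (hoc.out hz hm ⟨hc, by linarith⟩) hp
    · by_contra hc
      push Not at hc
      exact hcs (hoc.out hm hz ⟨by linarith, hc⟩) hq

lemma gap_form {E G : Set ℝ} (hE : IsClosed E) (hG : IsGapOf E G) :
    ∃ p ∈ E, ∃ q ∈ E, p < q ∧ (∀ z ∈ E, z < q → z ≤ p) ∧ G = Set.Ioo p q := by
  obtain ⟨⟨x, hx, rfl⟩, hb⟩ := hG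
  set G := connectedComponentIn Eᶜ x with hGd
  have hopen : IsOpen G := hE.isOpen_compl.connectedComponentIn
  have hpre : IsPreconnected G := isPreconnected_connectedComponentIn
  have hxG : x ∈ G := mem_connectedComponentIn hx
  have hbb : BddBelow G := hb.bddBelow
  have hba : BddAbove G := hb.bddAbove
  have hsub : G ⊆ Eᶜ := connectedComponentIn_subset _ _
  have hne : G.Nonempty := ⟨x, hxG⟩
  have hIoo : Set.Ioo (sInf G) (sSup G) ⊆ G :=
    IsConnected.Ioo_csInf_csSup_subset ⟨hne, hpre⟩ hbb hba
  have hnotInf : sInf G ∉ G := by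
    intro h
    obtain ⟨δ, hδ, hδG⟩ := Metric.isOpen_iff.1 hopen _ h
    have : sInf G - δ / 2 ∈ G := hδG (by rw [Metric.mem_ball, Real.dist_eq, abs_lt]; constructor <;> linarith)
    have := csInf_le hbb this
    linarith
  have hnotSup : sSup G ∉ G := by
    intro h
    obtain ⟨δ, hδ, hδG⟩ := Metric.isOpen_iff.1 hopen _ h
    have : sSup G + δ / 2 ∈ G := hδG (by rw [Metric.mem_ball, Real.dist_eq, abs_lt]; constructor <;> linarith)
    have := le_csSup hba this
    linarith
  have h1 : sInf G < x := lt_of_le_of_ne (csInf_le hbb hxG) (fun h => hnotInf (h ▸ hxG))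
  have h2 : x < sSup G := lt_of_le_of_ne (le_csSup hba hxG) (fun h => hnotSup (h ▸ hxG))
  have hGI : G = Set.Ioo (sInf G) (sSup G) := by
    apply Set.Subset.antisymm _ hIoo
    intro z hz
    exact ⟨lt_of_le_of_ne (csInf_le hbb hz) (fun h => hnotInf (h ▸ hz)),
      lt_of_le_of_ne (le_csSup hba hz) (fun h => hnotSup (h ▸ hz))⟩
  refine ⟨sInf G, ?_, sSup G, ?_, h1.trans h2, ?_, hGI⟩
  · by_contra hc
    have hs : Set.Ico (sInf G) (sSup G) ⊆ Eᶜ := by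
      intro z hz
      rcases eq_or_lt_of_le hz.1 with h | h
      · rw [← h]; exact hc
      · exact hsub (hIoo ⟨h, hz.2⟩)
    exact hnotInf (isPreconnected_Ico.subset_connectedComponentIn (x := x) ⟨h1.le, h2⟩ hs
      ⟨le_rfl, h1.trans h2⟩)
  · by_contra hc
    have hs : Set.Ioc (sInf G) (sSup G) ⊆ Eᶜ := by
      intro z hz
      rcases eq_or_lt_of_le hz.2 with h | h
      · rw [h]; exact hc
      · exact hsub (hIoo ⟨hz.1, h⟩)
    exact hnotSup (isPreconnected_Ioc.subset_connectedComponentIn (x := x) ⟨h1, h2.le⟩ hs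
      ⟨h1.trans h2, le_rfl⟩)
  · intro z hz hzq
    by_contra hc
    push Not at hc
    exact hsub (hIoo ⟨hc, hzq⟩) hz

/-- a nontrivial component located between two points of the complement -/
lemma comp_between {E : Set ℝ} {α β m M : ℝ} (hab : α < β) (hE : Set.Icc α β ⊆ E)
    (hm : m ∉ E) (hM : M ∉ E) (h1 : m < α) (h2 : β < M) :
    ∃ C, IsProperComponentOf E C ∧ C ⊆ Set.Ioo m M := by
  have hα : α ∈ E := hE ⟨le_rfl, hab.le⟩
  have hsub := isPreconnected_Icc.subset_connectedComponentIn (x := α)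
    (s := Set.Icc α β) ⟨le_rfl, hab.le⟩ hE
  refine ⟨connectedComponentIn E α, ⟨⟨α, hα, rfl⟩, ?_⟩, ?_⟩
  · exact ⟨α, hsub ⟨le_rfl, hab.le⟩, β, hsub ⟨hab.le, le_rfl⟩, hab.ne⟩
  · have hoc := (isPreconnected_connectedComponentIn (x := α) (F := E)).ordConnected
    have hmm := mem_connectedComponentIn hα
    have hcs := connectedComponentIn_subset E α
    intro z hz
    constructor
    · by_contra hc
      push Not at hc
      exact hm (hcs (hoc.out hz hmm ⟨hc, by linarith⟩))
    · by_contra hc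
      push Not at hc
      exact hM (hcs (hoc.out hmm hz ⟨by linarith, hc⟩))

lemma SelfSim.perfect {E : Set ℝ} {l x y : ℝ} (H : SelfSim E l x y) : Perfect E := by
  refine ⟨H.closed, ?_⟩
  intro q hq
  rw [accPt_iff_nhds]
  intro U hU
  obtain ⟨ε, hε, hεU⟩ := Metric.mem_nhds_iff.1 hU
  have hl := H.l0
  obtain ⟨n, hn⟩ := exists_pow_lt_of_lt_one (show 0 < ε / 2 by linarith) H.l1
  have hpn : 0 < l ^ n := pow_pos hl n
  obtain ⟨e, he, t, ht, hqe⟩ := H.tr_from n q hq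
  have heb := H.sub he
  have key : ∀ w ∈ E, w ≠ e → ∃ z ∈ U ∩ E, z ≠ q := by
    intro w hw hwe
    have hwb := H.sub hw
    refine ⟨l ^ n * w + t, ⟨hεU ?_, H.tr_into n w hw t ht⟩, ?_⟩
    · rw [Metric.mem_ball, Real.dist_eq, hqe, abs_lt]
      constructor <;> nlinarith [heb.1, heb.2, hwb.1, hwb.2]
    · intro h
      rw [hqe] at h
      have h' : l ^ n * w = l ^ n * e := by linarith
      exact hwe (mul_left_cancel₀ hpn.ne' h')
  by_cases h : (1 : ℝ) = e
  · exact key (-1) H.neg_one (by rw [← h]; norm_num)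
  · exact key 1 H.one h

lemma SelfSim.cantorval {E : Set ℝ} {l x y : ℝ} (H : SelfSim E l x y) : IsCantorval E := by
  have hl := H.l0
  have hs := H.sum
  have hg := H.gap
  refine ⟨H.perfect, ?_, ?_⟩
  · apply Set.infinite_of_injective_forall_mem
      (f := fun k : ℕ => Set.Ioo (-1 + l ^ k * ((-1 + 2 * l) + 1)) (-1 + l ^ k * ((-x - l) + 1)))
    · intro k j hkj
      have hlt : ∀ k : ℕ, -1 + l ^ k * ((-1 + 2 * l) + 1) < -1 + l ^ k * ((-x - l) + 1) := by
        intro k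
        have : 0 < l ^ k := pow_pos hl k
        nlinarith
      simp only at hkj
      have h := congrArg sInf hkj
      rw [csInf_Ioo (hlt k), csInf_Ioo (hlt j)] at h
      have h' : l ^ k * (2 * l) = l ^ j * (2 * l) := by linarith
      have h2 := mul_right_cancel₀ (by positivity) h'
      exact (pow_right_injective₀ hl H.l1.ne) h2
    · intro k
      have : 0 < l ^ k := pow_pos hl k
      refine isGap_Ioo (by nlinarith) (H.pull k _ H.u_mem) (H.pull k _ H.v_mem) ?_
      intro z hz hzv
      have := H.gapk k z hz (by nlinarith)
      nlinarith
  · intro G hG p hp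
    obtain ⟨p', hp', q, hq, hpq, hno, rfl⟩ := gap_form H.closed hG
    rw [csInf_Ioo hpq, csSup_Ioo hpq] at hp
    have hmidn : ∀ {u v : ℝ}, u < v → (∀ z ∈ E, z < v → z ≤ u) → ∀ w, u < w → w < v → w ∉ E := by
      intro u v huv h w h1 h2 hw
      have := h w hw h2
      linarith
    rcases hp with rfl | rfl
    · constructor
      · intro ε hε
        obtain ⟨⟨u, hu, v, hv, h1, h2, h3, h4⟩, -⟩ := H.acc_left hpq hp' hno ε hε
        refine ⟨Set.Ioo u v, isGap_Ioo h2 hu hv h4, ?_, ?_⟩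
        · intro h
          have h := congrArg sInf h
          rw [csInf_Ioo h2, csInf_Ioo hpq] at h
          linarith
        · exact Set.Ioo_subset_Ioo h1.le (by linarith)
      · intro ε hε
        obtain ⟨⟨u, hu, v, hv, h1, h2, h3, h4⟩, -⟩ := H.acc_left hpq hp' hno ε hε
        obtain ⟨-, α, β, g1, g2, g3, g4⟩ := H.acc_left hpq hp' hno (p - v) (by linarith)
        obtain ⟨C, hC, hCs⟩ := comp_between g2 g4 (hmidn h2 h4 ((u + v) / 2) (by linarith) (by linarith))
          (hmidn hpq hno ((p + min q (p + ε)) / 2)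
            (by have : p < min q (p + ε) := lt_min hpq (by linarith)
                linarith)
            (by have := min_le_left q (p + ε); linarith)) (by linarith)
            (by have : p < min q (p + ε) := lt_min hpq (by linarith)
                linarith)
        refine ⟨C, hC, hCs.trans (Set.Ioo_subset_Ioo (by linarith) ?_)⟩
        have := min_le_right q (p + ε)
        linarith
    · constructor
      · intro ε hε
        obtain ⟨⟨u, hu, v, hv, h1, h2, h3, h4⟩, -⟩ := H.acc_right hpq hq hno ε hε
        refine ⟨Set.Ioo u v, isGap_Ioo h2 hu hv h4, ?_, ?_⟩
        · intro h
          have h := congrArg sInf h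
          rw [csInf_Ioo h2, csInf_Ioo hpq] at h
          linarith
        · exact Set.Ioo_subset_Ioo (by linarith) h3.le
      · intro ε hε
        obtain ⟨⟨u, hu, v, hv, h1, h2, h3, h4⟩, -⟩ := H.acc_right hpq hq hno ε hε
        obtain ⟨-, α, β, g1, g2, g3, g4⟩ := H.acc_right hpq hq hno (u - p) (by linarith)
        have hmx : max p' (p - ε) < p := max_lt hpq (by linarith)
        have hm1 := le_max_left p' (p - ε)
        have hm2 := le_max_right p' (p - ε)
        obtain ⟨C, hC, hCs⟩ := comp_between g2 g4
          (hmidn hpq hno ((p + max p' (p - ε)) / 2) (by linarith) (by linarith))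
          (hmidn h2 h4 ((u + v) / 2) (by linarith) (by linarith)) (by linarith) (by linarith)
        exact ⟨C, hC, hCs.trans (Set.Ioo_subset_Ioo (by linarith) (by linarith))⟩

/-! ### The central Cantor set -/

lemma dSeq_succ (a : ℕ → ℝ) (n : ℕ) : dSeq a (n + 1) = dSeq a n * ((1 - a (n + 1)) / 2) := by
  unfold dSeq
  rw [Finset.prod_Icc_succ_top (by omega)]

lemma dSeq_zero (a : ℕ → ℝ) : dSeq a 0 = 1 := by simp [dSeq]

lemma dSeq_pos {a : ℕ → ℝ} (ha : ∀ n, a n < 1) (n : ℕ) : 0 < dSeq a n := by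
  induction n with
  | zero => simp [dSeq_zero]
  | succ n ih => rw [dSeq_succ]; have := ha (n + 1); exact mul_pos ih (by linarith)

lemma dSeq_le {a : ℕ → ℝ} (ha : ∀ n, a n < 1) (ha0 : ∀ n, 0 < a n) (n : ℕ) :
    dSeq a (n + 1) ≤ dSeq a n := by
  have := dSeq_pos ha n
  rw [dSeq_succ]
  have := ha0 (n + 1)
  nlinarith

lemma Il_append (a : ℕ → ℝ) (s : List ℕ) (i : ℕ) :
    Il a (s ++ [i]) = Il a s + i * (dSeq a s.length - dSeq a (s.length + 1)) := by
  unfold Il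
  rw [List.length_append, List.length_singleton, Finset.sum_range_succ]
  congr 1
  · apply Finset.sum_congr rfl
    intro j hj
    rw [Finset.mem_range] at hj
    rw [List.getD_append _ _ _ _ hj]
  · rw [List.getD_append_right _ _ _ _ le_rfl]
    simp

lemma step_anti {a : ℕ → ℝ} (ha : ∀ n, a n < 1) (ha0 : ∀ n, 0 < a n) (n : ℕ) :
    cantorStep a (n + 1) ⊆ cantorStep a n := by
  intro z hz
  simp only [cantorStep, Set.mem_iUnion, Set.mem_setOf_eq, exists_prop] at hz ⊢
  obtain ⟨t, ⟨hlen, ht⟩, hz⟩ := hz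
  rcases List.eq_nil_or_concat t with rfl | ⟨s, i, rfl⟩
  · simp at hlen
  simp only [List.concat_eq_append] at *
  have hsl : s.length = n := by simpa using hlen
  refine ⟨s, ⟨hsl, fun j hj => ht j (by simp [hj])⟩, ?_⟩
  rw [Il_append, hsl] at hz
  have hi : i ≤ 1 := ht i (by simp)
  have hle := dSeq_le ha ha0 n
  have := dSeq_pos ha (n + 1)
  have hi' : (i : ℝ) ≤ 1 := by exact_mod_cast hi
  have hi0 : (0 : ℝ) ≤ i := by positivity
  constructor <;> nlinarith [hz.1, hz.2]

lemma step_antitone {a : ℕ → ℝ} (ha : ∀ n, a n < 1) (ha0 : ∀ n, 0 < a n) :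
    Antitone (cantorStep a) := antitone_nat_of_succ_le (step_anti ha ha0)

lemma step_zero (a : ℕ → ℝ) : cantorStep a 0 = Set.Icc 0 1 := by
  ext z
  simp only [cantorStep, Set.mem_iUnion, Set.mem_setOf_eq, exists_prop]
  constructor
  · rintro ⟨t, ⟨hlen, -⟩, hz⟩
    rw [List.length_eq_zero_iff] at hlen
    subst hlen
    simpa [Il, dSeq_zero] using hz
  · intro hz
    exact ⟨[], by simp, by simpa [Il, dSeq_zero] using hz⟩

lemma step_closed (a : ℕ → ℝ) (n : ℕ) : IsClosed (cantorStep a n) := by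
  unfold cantorStep
  apply Set.Finite.isClosed_biUnion
  · have : {t : List ℕ | t.length = n ∧ ∀ j ∈ t, j ≤ 1} ⊆
        (List.map (fun i : Fin 2 => (i : ℕ))) '' {t : List (Fin 2) | t.length = n} := by
      rintro t ⟨hlen, ht⟩
      refine ⟨t.map (fun i => if i = 0 then 0 else 1), by simpa using hlen, ?_⟩
      rw [List.map_map]
      conv_rhs => rw [← List.map_id t]
      apply List.map_congr_left
      intro i hi
      have := ht i hi
      interval_cases i <;> simp
    exact ((List.finite_length_eq (Fin 2) n).image _).subset this
  · intro t _
    exact isClosed_Icc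

section periodic

variable {a : ℕ → ℝ} {l : ℝ}

lemma dSeq_two (hper : ∀ n, a (n + 2) = a n) (hl : dSeq a 2 = l) (n : ℕ) :
    dSeq a (n + 2) = l * dSeq a n := by
  induction n with
  | zero => simp [dSeq_zero, hl]
  | succ n ih =>
    rw [show n + 1 + 2 = (n + 2) + 1 by ring, dSeq_succ, ih, dSeq_succ a n,
      show n + 2 + 1 = (n + 1) + 2 by ring, hper]
    ring

lemma Il_cons_cons (hper : ∀ n, a (n + 2) = a n) (hl : dSeq a 2 = l) (i j : ℕ) (t : List ℕ) :
    Il a (i :: j :: t) = i * (1 - dSeq a 1) + j * (dSeq a 1 - l) + l * Il a t := by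
  unfold Il
  rw [List.length_cons, List.length_cons, Finset.sum_range_succ', Finset.sum_range_succ',
    Finset.mul_sum]
  have : ∀ k ∈ Finset.range t.length,
      (((i :: j :: t).getD (k + 1 + 1) 0 : ℕ) : ℝ) * (dSeq a (k + 1 + 1) - dSeq a (k + 1 + 1 + 1))
        = l * ((t.getD k 0 : ℝ) * (dSeq a k - dSeq a (k + 1))) := by
    intro k _
    rw [List.getD_cons_succ, List.getD_cons_succ, show k + 1 + 1 + 1 = (k + 1) + 2 by ring,
      show k + 1 + 1 = k + 2 by ring, dSeq_two hper hl, dSeq_two hper hl]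
    ring
  rw [Finset.sum_congr rfl this]
  simp [dSeq_zero, hl]
  ring

lemma step_two (hper : ∀ n, a (n + 2) = a n) (hl : dSeq a 2 = l) (hl0 : 0 < l) (n : ℕ) (z : ℝ) :
    z ∈ cantorStep a (n + 2) ↔ ∃ i j : Fin 2, ∃ w ∈ cantorStep a n,
      z = (i : ℕ) * (1 - dSeq a 1) + (j : ℕ) * (dSeq a 1 - l) + l * w := by
  simp only [cantorStep, Set.mem_iUnion, Set.mem_setOf_eq, exists_prop]
  constructor
  · rintro ⟨t, ⟨hlen, ht⟩, hz⟩
    match t, hlen with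
    | i :: j :: t, hlen =>
      have hi : i ≤ 1 := ht i (by simp)
      have hj : j ≤ 1 := ht j (by simp)
      rw [Il_cons_cons hper hl, dSeq_two hper hl] at hz
      refine ⟨⟨i, by omega⟩, ⟨j, by omega⟩,
        (z - (i * (1 - dSeq a 1) + j * (dSeq a 1 - l))) / l,
        ⟨t, ⟨by simpa using hlen, fun k hk => ht k (by simp [hk])⟩, ?_⟩, ?_⟩
      · constructor
        · rw [le_div_iff₀ hl0]; linarith [hz.1]
        · rw [div_le_iff₀ hl0]; linarith [hz.2]
      · field_simp
        ring
  · rintro ⟨i, j, w, ⟨t, ⟨hlen, ht⟩, hw⟩, rfl⟩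
    refine ⟨(i : ℕ) :: (j : ℕ) :: t, ⟨by simp [hlen], ?_⟩, ?_⟩
    · intro k hk
      simp only [List.mem_cons] at hk
      rcases hk with rfl | rfl | hk
      · omega
      · omega
      · exact ht k hk
    · rw [Il_cons_cons hper hl, dSeq_two hper hl]
      constructor <;> nlinarith [hw.1, hw.2]

lemma cantor_two (ha : ∀ n, a n < 1) (ha0 : ∀ n, 0 < a n)
    (hper : ∀ n, a (n + 2) = a n) (hl : dSeq a 2 = l) (hl0 : 0 < l) (z : ℝ) :
    z ∈ cantorSet a ↔ ∃ i j : Fin 2, ∃ w ∈ cantorSet a,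
      z = (i : ℕ) * (1 - dSeq a 1) + (j : ℕ) * (dSeq a 1 - l) + l * w := by
  have hanti := step_antitone ha ha0
  constructor
  · intro hz
    rw [cantorSet, Set.mem_iInter] at hz
    by_contra hc
    push Not at hc
    let W : Fin 2 → Fin 2 → ℝ := fun i j =>
      (z - ((i : ℕ) * (1 - dSeq a 1) + (j : ℕ) * (dSeq a 1 - l))) / l
    have hW : ∀ i j : Fin 2, z = (i : ℕ) * (1 - dSeq a 1) + (j : ℕ) * (dSeq a 1 - l) + l * W i j := by
      intro i j
      simp only [W]
      field_simp
      ring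
    have h1 : ∀ i j : Fin 2, ∃ n, W i j ∉ cantorStep a n := by
      intro i j
      by_contra hcc
      push Not at hcc
      exact hc i j (W i j) (by rw [cantorSet, Set.mem_iInter]; exact hcc) (hW i j)
    choose N hN using h1
    let M := N 0 0 + N 0 1 + N 1 0 + N 1 1
    obtain ⟨i, j, w, hw, hzw⟩ := (step_two hper hl hl0 M z).1 (hz (M + 2))
    have : w = W i j := by
      have h := hW i j
      have : l * w = l * W i j := by linarith
      exact mul_left_cancel₀ hl0.ne' this
    apply hN i j
    rw [← this]
    refine hanti ?_ hw
    fin_cases i <;> fin_cases j <;> simp [M] <;> omega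
  · rintro ⟨i, j, w, hw, rfl⟩
    rw [cantorSet, Set.mem_iInter] at hw ⊢
    intro n
    exact hanti (show n ≤ n + 2 by omega) ((step_two hper hl hl0 n _).2 ⟨i, j, w, hw n, rfl⟩)

lemma zero_mem_cantor (ha : ∀ n, a n < 1) : (0 : ℝ) ∈ cantorSet a := by
  rw [cantorSet, Set.mem_iInter]
  intro n
  simp only [cantorStep, Set.mem_iUnion, Set.mem_setOf_eq, exists_prop]
  have h0 : Il a (List.replicate n 0) = 0 := by
    unfold Il
    apply Finset.sum_eq_zero
    intro j hj
    rw [List.length_replicate, Finset.mem_range] at hj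
    simp [hj]
  refine ⟨List.replicate n 0, ⟨by simp, by simp⟩, ?_⟩
  rw [h0]
  have := dSeq_pos ha n
  exact ⟨le_rfl, by linarith⟩

lemma one_mem_cantor (ha : ∀ n, a n < 1) : (1 : ℝ) ∈ cantorSet a := by
  rw [cantorSet, Set.mem_iInter]
  intro n
  simp only [cantorStep, Set.mem_iUnion, Set.mem_setOf_eq, exists_prop]
  have h0 : Il a (List.replicate n 1) = 1 - dSeq a n := by
    induction n with
    | zero => simp [Il, dSeq_zero]
    | succ n ih =>
      rw [List.replicate_succ', Il_append, ih]
      simp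
  refine ⟨List.replicate n 1, ⟨by simp, by simp⟩, ?_⟩
  rw [h0]
  have := dSeq_pos ha n
  exact ⟨by linarith, by linarith⟩

lemma cantor_compact : IsCompact (cantorSet a) := by
  apply IsCompact.of_isClosed_subset (isCompact_Icc (a := (0 : ℝ)) (b := 1))
  · exact isClosed_iInter (step_closed a)
  · intro z hz
    rw [← step_zero a]
    exact Set.mem_iInter.1 hz 0

lemma cantor_sub : cantorSet a ⊆ Set.Icc 0 1 := by
  intro z hz
  rw [← step_zero a]
  exact Set.mem_iInter.1 hz 0

end periodic

lemma selfSim_periodic (a₁ a₂ : ℝ) (a : ℕ → ℝ)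
    (hadef : a = fun n => if n % 2 = 1 then a₁ else a₂)
    (ha₁pos : 0 < a₁) (ha₁ : a₁ < 1 / 3) (ha₂ : 1 / 3 < a₂) (ha₂lt : a₂ < 1)
    (h1 : 1 / 35 < a₁)
    (h2 : a₂ ≤ (3 * a₁ + 1 - 4 * Real.sqrt (a₁ ^ 2 + a₁)) / (1 - a₁)) :
    SelfSim (cantorSet a - cantorSet a) ((1 - a₁) / 2 * ((1 - a₂) / 2)) (1 - (1 - a₁) / 2)
      ((1 - a₁) / 2 - (1 - a₁) / 2 * ((1 - a₂) / 2)) := by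
  have ha : ∀ n, a n < 1 := by intro n; rw [hadef]; dsimp only; split_ifs <;> linarith
  have ha0 : ∀ n, 0 < a n := by intro n; rw [hadef]; dsimp only; split_ifs <;> linarith
  have hper : ∀ n, a (n + 2) = a n := by intro n; rw [hadef]; simp
  have hd1 : dSeq a 1 = (1 - a₁) / 2 := by
    have := dSeq_succ a 0
    rw [dSeq_zero, hadef] at this
    rw [hadef]
    simpa using this
  have hd2 : dSeq a 2 = (1 - a₁) / 2 * ((1 - a₂) / 2) := by
    have := dSeq_succ a 1
    rw [hd1] at this
    rw [this, hadef]
    simp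
  set l := (1 - a₁) / 2 * ((1 - a₂) / 2) with hl
  have hl0 : 0 < l := mul_pos (by linarith) (by linarith)
  have hlc : 3 * l < (1 - a₁) / 2 := by rw [hl]; nlinarith
  have q1 : 0 ≤ l ^ 2 + 2 * a₁ * l - a₁ := by
    rw [le_div_iff₀ (by linarith)] at h2
    have hs : Real.sqrt (a₁ ^ 2 + a₁) ≤ l + a₁ := by rw [hl]; nlinarith
    have := Real.sq_sqrt (show 0 ≤ a₁ ^ 2 + a₁ by positivity)
    have := Real.sqrt_nonneg (a₁ ^ 2 + a₁)
    nlinarith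
  have q2 : 1 / 7 ≤ l := by
    by_contra hc
    push Not at hc
    nlinarith
  have hcan := cantor_two ha ha0 hper hd2 hl0
  rw [hd1] at hcan
  refine ⟨hl0, by linarith, by ring, by linarith, by linarith, by linarith, ?_, ?_, ?_, ?_, ?_,
    ?_, ?_, ?_⟩
  · nlinarith
  · nlinarith
  · have hc : IsCompact (cantorSet a) := cantor_compact
    have := (hc.prod hc).image (f := fun p : ℝ × ℝ => p.1 - p.2) (by fun_prop)
    rw [Set.image_prod] at this
    exact this.isClosed
  · rintro _ ⟨u, hu, v, hv, rfl⟩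
    have := cantor_sub hu
    have := cantor_sub hv
    simp only [Set.mem_Icc] at *
    constructor <;> linarith
  · exact ⟨1, one_mem_cantor ha, 0, zero_mem_cantor ha, by simp⟩
  · rintro _ ⟨u, hu, v, hv, rfl⟩
    exact ⟨v, hv, u, hu, by simp⟩
  · rintro _ ⟨u, hu, v, hv, rfl⟩ _ ⟨i, hi, j, hj, rfl⟩
    have dec : ∀ i ∈ ({-1, 0, 1} : Set ℝ), ∃ s t : Fin 2, i = ((s : ℕ) : ℝ) - ((t : ℕ) : ℝ) := by
      intro i hi
      simp only [Set.mem_insert_iff, Set.mem_singleton_iff] at hi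
      rcases hi with rfl | rfl | rfl
      · exact ⟨0, 1, by simp⟩
      · exact ⟨0, 0, by simp⟩
      · exact ⟨1, 0, by simp⟩
    obtain ⟨s, t, rfl⟩ := dec i hi
    obtain ⟨s', t', rfl⟩ := dec j hj
    refine ⟨_, (hcan _).2 ⟨s, s', u, hu, rfl⟩, _, (hcan _).2 ⟨t, t', v, hv, rfl⟩, ?_⟩
    ring
  · rintro _ ⟨u, hu, v, hv, rfl⟩
    obtain ⟨s, s', u, hu', rfl⟩ := (hcan _).1 hu
    obtain ⟨t, t', v, hv', rfl⟩ := (hcan _).1 hv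
    have dec : ∀ s t : Fin 2, ((s : ℕ) : ℝ) - ((t : ℕ) : ℝ) ∈ ({-1, 0, 1} : Set ℝ) := by
      intro s t
      fin_cases s <;> fin_cases t <;> simp
    refine ⟨u - v, ⟨u, hu', v, hv', rfl⟩, _, ⟨_, dec s t, _, dec s' t', rfl⟩, ?_⟩
    ring

/-- For the 2-periodic sequence `a = (a₁, a₂, a₁, a₂, …)` with `a₁ < 1/3 < a₂`:
if `a₁ ∈ (1/35, (6√5 - 13)/11)` and `a₂ ≤ (3a₁ + 1 - 4√(a₁² + a₁))/(1 - a₁)`, then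
`C(a) - C(a)` is a Cantorval. -/
theorem cantorval_of_periodic_large (a₁ a₂ : ℝ) (a : ℕ → ℝ)
    (hadef : a = fun n => if n % 2 = 1 then a₁ else a₂)
    (ha₁pos : 0 < a₁) (ha₁ : a₁ < 1 / 3) (ha₂ : 1 / 3 < a₂) (ha₂lt : a₂ < 1)
    (h1 : 1 / 35 < a₁) (h1' : a₁ < (6 * Real.sqrt 5 - 13) / 11)
    (h2 : a₂ ≤ (3 * a₁ + 1 - 4 * Real.sqrt (a₁ ^ 2 + a₁)) / (1 - a₁)) :
    IsCantorval (cantorSet a - cantorSet a) := by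
  exact (selfSim_periodic a₁ a₂ a hadef ha₁pos ha₁ ha₂ ha₂lt h1 h2).cantorval

end CCS
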